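/- Let P, Q : Fin n → ℝ² be two configurations of n labeled points (injective, in general position) with the same radial system, i.e., ccw_P(i;j,k,l) ↔ ccw_Q(i;j,k,l) for all admissible i,j,k,l. Suppose there are distinct indices a, b such that in both configurations all other points lie strictly to the left of the directed line from the point labeled a to the point labeled b, i.e., χ_P(a,b,k) = +1 and χ_Q(a,b,k) = +1 for all k ∉ {a,b}. Then the chirotopes coincide: χ_P(i,j,k) = χ_Q(i,j,k) for all i,j,k. -/

import Mathlib

noncomputable def det2 (v w : ℝ × ℝ) : ℝ := v.1 * w.2 - v.2 * w.1

noncomputable def chi {α : Type*} (P : α → ℝ × ℝ) (i j k : α) : ℝ :=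
  Real.sign (det2 (P j - P i) (P k - P i))

def GenPos {α : Type*} (P : α → ℝ × ℝ) : Prop :=
  ∀ i j k : α, i ≠ j → i ≠ k → j ≠ k → chi P i j k ≠ 0

def Ccw {α : Type*} (P : α → ℝ × ℝ) (i j k l : α) : Prop :=
  (chi P i j k = 1 ∧ chi P i k l = 1) ∨
  (chi P i k l = 1 ∧ chi P i l j = 1) ∨
  (chi P i l j = 1 ∧ chi P i j k = 1)

def Admissible {α : Type*} (i j k l : α) : Prop :=
  i ≠ j ∧ i ≠ k ∧ i ≠ l ∧ j ≠ k ∧ j ≠ l ∧ k ≠ l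

def SameRadial {α : Type*} (P Q : α → ℝ × ℝ) : Prop :=
  ∀ i j k l : α, Admissible i j k l → (Ccw P i j k l ↔ Ccw Q i j k l)

def SameUndirected {α : Type*} (P Q : α → ℝ × ℝ) : Prop :=
  ∀ i : α, (∀ j k l : α, Admissible i j k l → (Ccw Q i j k l ↔ Ccw P i j k l)) ∨
           (∀ j k l : α, Admissible i j k l → (Ccw Q i j k l ↔ Ccw P i l k j))

def ExtremeSet {α : Type*} (P : α → ℝ × ℝ) : Set α :=
  {i | P i ∉ convexHull ℝ (P '' {j | j ≠ i})}

def Important {n : ℕ} (P₀ : Fin n → ℝ × ℝ) (H : Set (Fin n)) : Prop :=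
  ∃ Q : Fin n → ℝ × ℝ, Function.Injective Q ∧ GenPos Q ∧ SameRadial P₀ Q ∧ ExtremeSet Q = H

def lineThrough (p q : ℝ × ℝ) : Set (ℝ × ℝ) := {x | ∃ t : ℝ, x = p + t • (q - p)}

theorem chi_rotate {α : Type*} (P : α → ℝ × ℝ) (i j k : α) : chi P j k i = chi P i j k := by
  simp only [chi, det2, Prod.fst_sub, Prod.snd_sub]
  congr 1
  ring

theorem chi_swap {α : Type*} (P : α → ℝ × ℝ) (i j k : α) : chi P i k j = -chi P i j k := by
  simp only [chi, det2, Prod.fst_sub, Prod.snd_sub, ← Real.sign_neg]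
  congr 1
  ring

theorem chi_eq_zero_of_not_distinct {α : Type*} (P : α → ℝ × ℝ) {i j k : α}
    (h : ¬(i ≠ j ∧ i ≠ k ∧ j ≠ k)) : chi P i j k = 0 := by
  have h' : i = j ∨ i = k ∨ j = k := by tauto
  rcases h' with rfl | rfl | rfl <;> simp [chi, det2, mul_comm]

theorem GenPos.chi_eq_one_or_neg_one {α : Type*} {P : α → ℝ × ℝ} (hP : GenPos P) {i j k : α}
    (hij : i ≠ j) (hik : i ≠ k) (hjk : j ≠ k) : chi P i j k = 1 ∨ chi P i j k = -1 := by
  have h := hP i j k hij hik hjk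
  rcases Real.sign_apply_eq (det2 (P j - P i) (P k - P i)) with h' | h' | h'
  · exact Or.inr h'
  · exact absurd h' h
  · exact Or.inl h'

theorem det2_pos_of_chi_eq_one {α : Type*} {P : α → ℝ × ℝ} {i j k : α} (h : chi P i j k = 1) :
    0 < det2 (P j - P i) (P k - P i) := by
  by_contra! h'
  rcases h'.lt_or_eq with h' | h'
  · rw [chi, Real.sign_of_neg h'] at h
    norm_num at h
  · rw [chi, h', Real.sign_zero] at h
    norm_num at h

/-- Points in an open half-plane bounded by a line through `a` are not cyclically ordered
around `a`. -/
theorem not_chi_cyclic {α : Type*} {P : α → ℝ × ℝ} {a b i j k : α}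
    (hi : chi P a b i = 1) (hj : chi P a b j = 1) (hk : chi P a b k = 1) :
    ¬(chi P a i j = 1 ∧ chi P a j k = 1 ∧ chi P a k i = 1) := by
  rintro ⟨hij, hjk, hki⟩
  have h₁ := mul_pos (det2_pos_of_chi_eq_one hi) (det2_pos_of_chi_eq_one hjk)
  have h₂ := mul_pos (det2_pos_of_chi_eq_one hj) (det2_pos_of_chi_eq_one hki)
  have h₃ := mul_pos (det2_pos_of_chi_eq_one hk) (det2_pos_of_chi_eq_one hij)
  simp only [det2] at h₁ h₂ h₃
  linarith

/-- If `j` and `k` lie on the same side of the line through `i` and `a`, the radial order of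
`a, j, k` around `i` is the orientation of `i, j, k`. -/
theorem ccw_iff_of_chi_eq {α : Type*} {P : α → ℝ × ℝ} (hP : GenPos P) {i a j k : α}
    (h : Admissible i a j k) (hs : chi P i a j = chi P i a k) :
    Ccw P i a j k ↔ chi P i j k = 1 := by
  have hka := chi_swap P i a k
  unfold Ccw
  rw [hka, hs]
  rcases hP.chi_eq_one_or_neg_one h.1 h.2.2.1 h.2.2.2.2.1 with h' | h' <;> norm_num [h']

theorem SameRadial.chi_eq_of_chi_eq {α : Type*} {P Q : α → ℝ × ℝ} (hP : GenPos P) (hQ : GenPos Q)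
    (hR : SameRadial P Q) {i a j k : α} (h : Admissible i a j k)
    (hj : chi P i a j = chi Q i a j) (hk : chi P i a k = chi Q i a k)
    (hs : chi P i a j = chi P i a k) : chi P i j k = chi Q i j k := by
  have hiff := hR i a j k h
  rw [ccw_iff_of_chi_eq hP h hs, ccw_iff_of_chi_eq hQ h (by rw [← hj, ← hk, hs])] at hiff
  obtain ⟨-, hij, hik, -, -, hjk⟩ := h
  rcases hP.chi_eq_one_or_neg_one hij hik hjk with hp | hp <;>
    rcases hQ.chi_eq_one_or_neg_one hij hik hjk with hq | hq <;>
    grind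

/-- the radial system together with a common directed convex hull
edge determines the chirotope. -/
theorem radial_and_hull_edge_determine_chirotope {n : ℕ}
    (P Q : Fin n → ℝ × ℝ)
    (hPinj : Function.Injective P) (hPgp : GenPos P)
    (hQinj : Function.Injective Q) (hQgp : GenPos Q)
    (hR : SameRadial P Q)
    (a b : Fin n) (hab : a ≠ b)
    (hPleft : ∀ k : Fin n, k ≠ a → k ≠ b → chi P a b k = 1)
    (hQleft : ∀ k : Fin n, k ≠ a → k ≠ b → chi Q a b k = 1) :
    ∀ i j k : Fin n, chi P i j k = chi Q i j k := by
  have hA : ∀ j k, chi P a j k = chi Q a j k := by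
    intro j k
    by_cases hd : a ≠ j ∧ a ≠ k ∧ j ≠ k
    · obtain ⟨haj, hak, hjk⟩ := hd
      rcases eq_or_ne j b with rfl | hjb
      · rw [hPleft k hak.symm hjk.symm, hQleft k hak.symm hjk.symm]
      rcases eq_or_ne k b with rfl | hkb
      · rw [chi_swap P a k j, chi_swap Q a k j, hPleft j haj.symm hjk, hQleft j haj.symm hjk]
      have hPj := hPleft j haj.symm hjb
      have hPk := hPleft k hak.symm hkb
      refine hR.chi_eq_of_chi_eq hPgp hQgp ⟨hab, haj, hak, hjb.symm, hkb.symm, hjk⟩ ?_ ?_ ?_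
      · rw [hPj, hQleft j haj.symm hjb]
      · rw [hPk, hQleft k hak.symm hkb]
      · rw [hPj, hPk]
    · rw [chi_eq_zero_of_not_distinct P hd, chi_eq_zero_of_not_distinct Q hd]
  have hflip : ∀ (R : Fin n → ℝ × ℝ) (i j : Fin n), chi R i a j = -chi R a i j := by
    intro R i j
    rw [← chi_rotate R i a j, chi_swap]
  have hvertex : ∀ i j k, a ≠ i → a ≠ j → a ≠ k → i ≠ j → i ≠ k → j ≠ k →
      chi P a i j = chi P a i k → chi P i j k = chi Q i j k := by
    intro i j k hai haj hak hij hik hjk hs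
    refine hR.chi_eq_of_chi_eq hPgp hQgp ⟨hai.symm, hij, hik, haj, hak, hjk⟩ ?_ ?_ ?_
    · rw [hflip, hflip, hA]
    · rw [hflip, hflip, hA]
    · rw [hflip, hflip, hs]
  intro i j k
  by_cases hd : i ≠ j ∧ i ≠ k ∧ j ≠ k
  swap
  · rw [chi_eq_zero_of_not_distinct P hd, chi_eq_zero_of_not_distinct Q hd]
  obtain ⟨hij, hik, hjk⟩ := hd
  rcases eq_or_ne a i with rfl | hai
  · exact hA j k
  rcases eq_or_ne a j with rfl | haj
  · rw [← chi_rotate P i, ← chi_rotate Q i, hA]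
  rcases eq_or_ne a k with rfl | hak
  · rw [chi_rotate P a, chi_rotate Q a, hA]
  by_cases hi : chi P a i j = chi P a i k
  · exact hvertex i j k hai haj hak hij hik hjk hi
  by_cases hj : chi P a j k = chi P a j i
  · rw [← chi_rotate P i, ← chi_rotate Q i]
    exact hvertex j k i haj hak hai hjk hij.symm hik.symm hj
  exfalso
  have hbi : i ≠ b := by
    rintro rfl
    exact hi (by rw [hPleft j haj.symm hij.symm, hPleft k hak.symm hik.symm])
  have hbj : j ≠ b := by
    rintro rfl
    exact hj (by rw [hPleft k hak.symm hjk.symm, hPleft i hai.symm hij])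
  have hij' := chi_swap P a i j
  have hki' := chi_swap P a i k
  have hkj' := chi_swap P a j k
  have hPi := hPleft i hai.symm hbi
  have hPj := hPleft j haj.symm hbj
  rcases eq_or_ne k b with rfl | hbk
  · rw [hPi] at hki'
    rw [hPj] at hkj'
    grind [hPgp.chi_eq_one_or_neg_one hai haj hij]
  have hPk := hPleft k hak.symm hbk
  have h₁ := not_chi_cyclic hPi hPj hPk
  have h₂ := not_chi_cyclic hPi hPk hPj
  rcases hPgp.chi_eq_one_or_neg_one hai haj hij with h₃ | h₃ <;>
    rcases hPgp.chi_eq_one_or_neg_one hai hak hik with h₄ | h₄ <;>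
    rcases hPgp.chi_eq_one_or_neg_one haj hak hjk with h₅ | h₅ <;>
    grind
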